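/- If P, Q ∈ CC₊ with P ≠ R̄₊ⁿ and Q ≠ R̄₊ⁿ, then their copolar sum P ⊕ Q = (P° + Q°)° again belongs to CC₊ and satisfies P ⊕ Q ≠ R̄₊ⁿ. -/

import Mathlib

open Set MeasureTheory Pointwise

noncomputable section

abbrev En (n : ℕ) := EuclideanSpace ℝ (Fin n)

/-- Standard inner product on ℝⁿ. -/
def dotp {n : ℕ} (x y : En n) : ℝ := ∑ i, x i * y i

/-- Closed positive orthant R̄₊ⁿ. -/
def posOrthantCl (n : ℕ) : Set (En n) := {x | ∀ i, 0 ≤ x i}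
/-- Open positive orthant R₊ⁿ. -/
def posOrthantOp (n : ℕ) : Set (En n) := {x | ∀ i, 0 < x i}
/-- Closed negative orthant R̄₋ⁿ. -/
def negOrthantCl (n : ℕ) : Set (En n) := {x | ∀ i, x i ≤ 0}
/-- Open negative orthant R₋ⁿ. -/
def negOrthantOp (n : ℕ) : Set (En n) := {x | ∀ i, x i < 0}

/-- Copolar A° = {x : ⟨x,y⟩ ≤ −1 for all y ∈ A}. -/
def copolar {n : ℕ} (A : Set (En n)) : Set (En n) := {x | ∀ y ∈ A, dotp x y ≤ -1}

/-- Membership in C₊: closed convex subset of R̄₊ⁿ with A + R₊ⁿ ⊆ A. -/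
def memCplus {n : ℕ} (A : Set (En n)) : Prop :=
  IsClosed A ∧ Convex ℝ A ∧ A ⊆ posOrthantCl n ∧ A + posOrthantOp n ⊆ A

/-- Membership in C₋: closed convex subset of R̄₋ⁿ with A + R₋ⁿ ⊆ A. -/
def memCminus {n : ℕ} (A : Set (En n)) : Prop :=
  IsClosed A ∧ Convex ℝ A ∧ A ⊆ negOrthantCl n ∧ A + negOrthantOp n ⊆ A

/-- Membership in CC₊: member of C₊ with bounded complement in R̄₊ⁿ. -/
def memCCplus {n : ℕ} (P : Set (En n)) : Prop :=
  memCplus P ∧ Bornology.IsBounded (posOrthantCl n \ P)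

/-- Membership in UC₋: nonempty member of C₋ contained in s* + R̄₋ⁿ for some s* ∈ R₋ⁿ. -/
def memUCminus {n : ℕ} (L : Set (En n)) : Prop :=
  L.Nonempty ∧ memCminus L ∧ ∃ s ∈ negOrthantOp n, L ⊆ s +ᵥ negOrthantCl n

/-- Support function of a set, with values in EReal. -/
def suppFn {n : ℕ} (A : Set (En n)) (x : En n) : EReal := ⨆ y ∈ A, ((dotp x y : ℝ) : EReal)

/-- Legendre transform of an EReal-valued function. -/
def legendre {n : ℕ} (f : En n → EReal) (y : En n) : EReal :=
  ⨆ x, ((dotp x y : ℝ) : EReal) - f x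

lemma dotp_eq_inner {n : ℕ} (x y : En n) : dotp x y = inner ℝ x y := by
  simp [dotp, PiLp.inner_apply, mul_comm]

lemma zero_notMem_of_memCplus {n : ℕ} {P : Set (En n)} (hP : memCplus P)
    (hne : P ≠ posOrthantCl n) : (0 : En n) ∉ P := by
  obtain ⟨hcl, -, hsub, hadd⟩ := hP
  intro h0
  refine hne (hsub.antisymm fun x hx => ?_)
  let v : En n := WithLp.toLp 2 fun _ => 1
  have hlim : Filter.Tendsto (fun t : ℝ => x + t • v) (nhdsWithin 0 (Ioi 0)) (nhds x) := by
    have hc : Continuous fun t : ℝ => x + t • v := by fun_prop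
    simpa using (hc.tendsto 0).mono_left nhdsWithin_le_nhds
  refine hcl.mem_of_tendsto hlim ?_
  filter_upwards [self_mem_nhdsWithin] with t ht
  refine hadd ⟨0, h0, x + t • v, fun i => ?_, by simp⟩
  have := hx i
  have ht' : 0 < t := ht
  simp [v]
  linarith

lemma copolar_nonempty {n : ℕ} {P : Set (En n)} (hcl : IsClosed P) (hconv : Convex ℝ P)
    (h0 : (0 : En n) ∉ P) : (copolar P).Nonempty := by
  obtain ⟨f, u, hu, hf⟩ := geometric_hahn_banach_point_closed hconv hcl h0
  rw [map_zero] at hu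
  refine ⟨(-u⁻¹) • (InnerProductSpace.toDual ℝ (En n)).symm f, fun y hy => ?_⟩
  have hy' := hf y hy
  rw [dotp_eq_inner, inner_smul_left, InnerProductSpace.toDual_symm_apply]
  have : 1 ≤ u⁻¹ * f y := by
    rw [inv_mul_eq_div, one_le_div hu]
    exact hy'.le
  simp
  linarith

lemma exists_copolar_apply_le {n : ℕ} {P : Set (En n)} (hP : memCCplus P) :
    ∃ c > 0, ∀ x ∈ copolar P, ∀ i, x i ≤ -c := by
  obtain ⟨R, hR, hb⟩ := hP.2.exists_pos_norm_le
  refine ⟨(R + 1)⁻¹, by positivity, fun x hx i => ?_⟩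
  have hmem : EuclideanSpace.single i (R + 1) ∈ P := by
    by_contra hcon
    have hle := hb (EuclideanSpace.single i (R + 1)) ⟨fun j => ?_, hcon⟩
    · rw [PiLp.norm_single, Real.norm_of_nonneg (by positivity)] at hle
      linarith
    · by_cases h : j = i
      · subst h
        simp
        positivity
      · simp [h]
  have h := hx _ hmem
  rw [dotp_eq_inner, EuclideanSpace.inner_single_right] at h
  simp at h
  have hR1 : 0 < R + 1 := by positivity
  have : (R + 1)⁻¹ * ((R + 1) * x i) ≤ (R + 1)⁻¹ * -1 :=
    mul_le_mul_of_nonneg_left h (by positivity)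
  rw [inv_mul_cancel_left₀ hR1.ne'] at this
  linarith

lemma isClosed_copolar {n : ℕ} (A : Set (En n)) : IsClosed (copolar A) := by
  have : copolar A = ⋂ y ∈ A, {x : En n | inner ℝ x y ≤ -1} := by
    ext x
    simp [copolar, dotp_eq_inner]
  rw [this]
  exact isClosed_biInter fun y _ => isClosed_le (by fun_prop) continuous_const

lemma convex_copolar {n : ℕ} (A : Set (En n)) : Convex ℝ (copolar A) := by
  intro x hx z hz a b ha hb hab y hy
  have h1 := mul_le_mul_of_nonneg_left (hx y hy) ha
  have h2 := mul_le_mul_of_nonneg_left (hz y hy) hb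
  rw [dotp_eq_inner] at h1 h2 ⊢
  rw [inner_add_left, real_inner_smul_left, real_inner_smul_left]
  linarith

lemma copolar_sub_single_mem {n : ℕ} {A : Set (En n)} (hA : A ⊆ posOrthantCl n) {x : En n}
    (hx : x ∈ copolar A) (i : Fin n) {t : ℝ} (ht : 0 ≤ t) :
    x - EuclideanSpace.single i t ∈ copolar A := by
  intro y hy
  have h := hx y hy
  have := mul_nonneg ht (hA hy i)
  rw [dotp_eq_inner] at h ⊢
  rw [inner_sub_left, EuclideanSpace.inner_single_left]
  simp
  linarith

lemma copolar_subset_posOrthantCl {n : ℕ} {S : Set (En n)} (hne : S.Nonempty)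
    (hS : ∀ s ∈ S, ∀ i, ∀ t : ℝ, 0 ≤ t → s - EuclideanSpace.single i t ∈ S) :
    copolar S ⊆ posOrthantCl n := by
  intro x hx i
  obtain ⟨s, hs⟩ := hne
  by_contra! hneg
  have ht : 0 ≤ |dotp x s| / -x i := div_nonneg (abs_nonneg _) (by linarith)
  have h := hx _ (hS s hs i _ ht)
  rw [dotp_eq_inner, inner_sub_right, EuclideanSpace.inner_single_right, ← dotp_eq_inner] at h
  have : |dotp x s| / -x i * x i = -|dotp x s| := by
    rw [div_neg, neg_mul, div_mul_cancel₀ _ hneg.ne]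
  simp at h
  have := neg_abs_le (dotp x s)
  linarith

lemma memCCplus_copolar {n : ℕ} {S : Set (En n)} (hne : S.Nonempty)
    (hS : ∀ s ∈ S, ∀ i, ∀ t : ℝ, 0 ≤ t → s - EuclideanSpace.single i t ∈ S)
    {c : ℝ} (hc : 0 < c) (hSc : ∀ s ∈ S, ∀ i, s i ≤ -c) : memCCplus (copolar S) := by
  refine ⟨⟨isClosed_copolar S, convex_copolar S, copolar_subset_posOrthantCl hne hS, ?_⟩, ?_⟩
  · rintro _ ⟨x, hx, p, hp, rfl⟩ s hs
    have h := hx s hs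
    have hps : dotp p s ≤ 0 := Finset.sum_nonpos fun i _ =>
      mul_nonpos_of_nonneg_of_nonpos (hp i).le (by linarith [hSc s hs i])
    rw [dotp_eq_inner] at h hps ⊢
    rw [inner_add_left]
    linarith
  · rw [isBounded_iff_forall_norm_le]
    refine ⟨c⁻¹, fun x ⟨hx, hxS⟩ => ?_⟩
    by_contra! hlt
    refine hxS fun s hs => ?_
    have hsum : ‖x‖ ≤ ∑ i, x i := by
      have hn : 0 ≤ ∑ i, x i := Finset.sum_nonneg fun i _ => hx i
      rw [EuclideanSpace.norm_eq, Real.sqrt_le_left hn]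
      simpa using Finset.sum_sq_le_sq_sum_of_nonneg fun i _ => hx i
    have h1 : dotp x s ≤ ∑ i, x i * -c :=
      Finset.sum_le_sum fun i _ => mul_le_mul_of_nonneg_left (hSc s hs i) (hx i)
    rw [← Finset.sum_mul] at h1
    have h2 : c⁻¹ * c ≤ (∑ i, x i) * c :=
      mul_le_mul_of_nonneg_right (hlt.le.trans hsum) hc.le
    rw [inv_mul_cancel₀ hc.ne'] at h2
    linarith

/-- If P, Q ∈ CC₊ with P ≠ R̄₊ⁿ and Q ≠ R̄₊ⁿ, then the copolar sum
P ⊕ Q = (P° + Q°)° belongs to CC₊ and P ⊕ Q ≠ R̄₊ⁿ. -/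
theorem copolarSum_memCCplus (n : ℕ) (hn : 1 ≤ n) (P Q : Set (En n))
    (hP : memCCplus P) (hQ : memCCplus Q)
    (hP' : P ≠ posOrthantCl n) (hQ' : Q ≠ posOrthantCl n) :
    memCCplus (copolar (copolar P + copolar Q)) ∧
      copolar (copolar P + copolar Q) ≠ posOrthantCl n := by
  have hne : (copolar P + copolar Q).Nonempty :=
    (copolar_nonempty hP.1.1 hP.1.2.1 (zero_notMem_of_memCplus hP.1 hP')).add
      (copolar_nonempty hQ.1.1 hQ.1.2.1 (zero_notMem_of_memCplus hQ.1 hQ'))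
  obtain ⟨c, hc, hPc⟩ := exists_copolar_apply_le hP
  obtain ⟨d, hd, hQd⟩ := exists_copolar_apply_le hQ
  refine ⟨memCCplus_copolar hne ?_ (add_pos hc hd) ?_, fun h => ?_⟩
  · rintro _ ⟨p, hp, q, hq, rfl⟩ i t ht
    exact ⟨_, copolar_sub_single_mem hP.1.2.2.1 hp i ht, q, hq, by simp; abel⟩
  · rintro _ ⟨p, hp, q, hq, rfl⟩ i
    have := hPc p hp i
    have := hQd q hq i
    simp
    linarith
  · obtain ⟨s, hs⟩ := hne
    have h0 : (0 : En n) ∈ posOrthantCl n := fun i => by simp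
    rw [← h] at h0
    have := h0 s hs
    simp [dotp] at this
    linarith
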